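/- Let r ≥ 1 be an integer and let b_1, …, b_r be integers whose sum equals k·r + l, where k is an integer and 0 ≤ l < r. Then σ_2(b_1, …, b_r) ≤ σ_2(k, …, k, k+1, …, k+1), where the right side is the second elementary symmetric polynomial of the vector with r − l entries equal to k and l entries equal to k + 1. -/

import Mathlib

/-- The `k`-th elementary symmetric polynomial of the tuple `v`. -/
def esymm {R : Type*} [CommSemiring R] {n : ℕ} (v : Fin n → R) (k : ℕ) : R :=
  ∑ S ∈ Finset.powersetCard k Finset.univ, ∏ j ∈ S, v j

theorem Finset.sq_sum_eq_sum_sq_add_two_mul_sum_powersetCard {ι R : Type*} [CommSemiring R]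
    (s : Finset ι) (v : ι → R) :
    (∑ i ∈ s, v i) ^ 2 =
      ∑ i ∈ s, v i ^ 2 + 2 * ∑ S ∈ Finset.powersetCard 2 s, ∏ j ∈ S, v j := by
  classical
  induction s using Finset.induction_on with
  | empty => simp [Finset.powersetCard_eq_empty.2 (show (∅ : Finset ι).card < 2 by simp)]
  | insert a s ha ih =>
    have hinj : Set.InjOn (insert a) (Finset.powersetCard 1 s : Set (Finset ι)) := by
      intro S hS T hT h
      have hS' : a ∉ S := fun h' => ha ((Finset.mem_powersetCard.1 hS).1 h')
      have hT' : a ∉ T := fun h' => ha ((Finset.mem_powersetCard.1 hT).1 h')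
      rw [← Finset.erase_insert hS', h, Finset.erase_insert hT']
    have hdisj : Disjoint (Finset.powersetCard 2 s)
        ((Finset.powersetCard 1 s).image (insert a)) := by
      refine Finset.disjoint_left.2 fun S hS hS' => ?_
      obtain ⟨T, -, rfl⟩ := Finset.mem_image.1 hS'
      exact ha ((Finset.mem_powersetCard.1 hS).1 (Finset.mem_insert_self a T))
    have hsum : ∑ S ∈ Finset.powersetCard 1 s, ∏ j ∈ insert a S, v j
        = v a * ∑ i ∈ s, v i := by
      rw [Finset.powersetCard_one, Finset.sum_map, Finset.mul_sum]
      refine Finset.sum_congr rfl fun i hi => ?_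
      have hai : a ≠ i := fun h => ha (h ▸ hi)
      simp [Finset.prod_pair hai]
    rw [Finset.powersetCard_succ_insert ha, Finset.sum_union hdisj, Finset.sum_image hinj, hsum,
      Finset.sum_insert ha, Finset.sum_insert ha, add_sq, ih]
    ring

theorem sq_sum_eq_sum_sq_add_two_mul_esymm {R : Type*} [CommSemiring R] {n : ℕ} (v : Fin n → R) :
    (∑ i, v i) ^ 2 = ∑ i, v i ^ 2 + 2 * esymm v 2 :=
  Finset.univ.sq_sum_eq_sum_sq_add_two_mul_sum_powersetCard v

theorem sum_ite_lt_sub {r l : ℕ} (hl : l ≤ r) (k : ℤ) :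
    ∑ i : Fin r, (if (i : ℕ) < r - l then k else k + 1) = k * r + l := by
  obtain ⟨m, rfl⟩ := Nat.exists_eq_add_of_le' hl
  rw [Fin.sum_univ_add]
  simp
  ring

/-- Among integer vectors of length `r` with fixed sum `k·r + l` (`0 ≤ l < r`),
`σ₂` is maximized by the vector with `r − l` entries equal to `k` and `l` entries
equal to `k + 1`. -/
theorem stmt_17 (r : ℕ) (hr : 1 ≤ r) (k : ℤ) (l : ℕ) (hl : l < r)
    (b : Fin r → ℤ) (hsum : ∑ i, b i = k * r + l) :
    esymm b 2 ≤ esymm (fun i : Fin r => if (i : ℕ) < r - l then k else k + 1) 2 := by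
  set c : Fin r → ℤ := fun i => if (i : ℕ) < r - l then k else k + 1 with hc
  have hcsum : ∑ i, c i = k * r + l := sum_ite_lt_sub hl.le k
  have hsq : ∑ i, c i ^ 2 ≤ ∑ i, b i ^ 2 := by
    have hcb : ∑ i, (c i ^ 2 - (2 * k + 1) * c i) ≤ ∑ i, (b i ^ 2 - (2 * k + 1) * b i) := by
      refine Finset.sum_le_sum fun i _ => ?_
      have hci : c i ^ 2 - (2 * k + 1) * c i = -(k * (k + 1)) := by
        simp only [hc]
        split_ifs <;> ring
      rcases le_or_gt (b i) k with h | h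
      · nlinarith
      · nlinarith [Int.add_one_le_of_lt h]
    simp only [Finset.sum_sub_distrib, ← Finset.mul_sum, hcsum, hsum] at hcb
    linarith
  have hb2 := sq_sum_eq_sum_sq_add_two_mul_esymm b
  have hc2 := sq_sum_eq_sum_sq_add_two_mul_esymm c
  rw [hsum] at hb2
  rw [hcsum] at hc2
  linarith
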